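/- In the braid group B_N the pure braid relation P1 holds: for indices with 1 ≤ i < j < r < s ≤ N, and also for indices with 1 ≤ r < i < j < s ≤ N, one has a_{ij}⁻¹ a_{rs} a_{ij} = a_{rs}. -/

import Mathlib

open FreeGroup

namespace BraidPaper

/-- Relators for the Artin braid group on generators `σ_1, …, σ_n`
(so this presents the braid group `B_{n+1}`); the generator with index `k : Fin n`
represents `σ_{k+1}`. -/
def braidRels (n : ℕ) : Set (FreeGroup (Fin n)) :=
  {x | ∃ k l : Fin n, ((k : ℕ) + 2 ≤ (l : ℕ) ∨ (l : ℕ) + 2 ≤ (k : ℕ)) ∧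
      x = of k * of l * (of k)⁻¹ * (of l)⁻¹} ∪
  {x | ∃ k l : Fin n, (l : ℕ) = (k : ℕ) + 1 ∧
      x = of k * of l * of k * (of l)⁻¹ * (of k)⁻¹ * (of l)⁻¹}

/-- The braid group with `n` generators `σ_1, …, σ_n`, i.e. the Artin braid group
`B_{n+1}`.  Thus `B_N = BraidGroup (N-1)`. -/
abbrev BraidGroup (n : ℕ) : Type := PresentedGroup (braidRels n)

/-- The generator `σ_k` (1-based) of `BraidGroup n`, for `1 ≤ k ≤ n`. -/
def sgen (n k : ℕ) : BraidGroup n :=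
  if h : 1 ≤ k ∧ k ≤ n then PresentedGroup.of ⟨k - 1, by omega⟩ else 1

/-- The descending product `σ_{j-1} σ_{j-2} ⋯ σ_{i+1}`. -/
def dprod (n i j : ℕ) : BraidGroup n :=
  ((List.range (j - 1 - i)).map fun t => sgen n (j - 1 - t)).prod

/-- The pure braid generator
`a_{ij} = σ_{j-1} σ_{j-2} ⋯ σ_{i+1} σ_i² σ_{i+1}⁻¹ ⋯ σ_{j-2}⁻¹ σ_{j-1}⁻¹`. -/
def agen (n i j : ℕ) : BraidGroup n := dprod n i j * (sgen n i) ^ 2 * (dprod n i j)⁻¹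
theorem sgen_of_mem {n k : ℕ} (h1 : 1 ≤ k) (hn : k ≤ n) :
    sgen n k = PresentedGroup.mk (braidRels n) (of ⟨k - 1, by omega⟩) :=
  dif_pos ⟨h1, hn⟩

theorem sgen_commute {n k l : ℕ} (h : k + 2 ≤ l) : Commute (sgen n k) (sgen n l) := by
  by_cases hk : 1 ≤ k ∧ k ≤ n
  · by_cases hl : 1 ≤ l ∧ l ≤ n
    · have hrel := PresentedGroup.one_of_mem
        (show _ ∈ braidRels n from Or.inl ⟨⟨k - 1, by omega⟩, ⟨l - 1, by omega⟩,
          Or.inl (by simp only; omega), rfl⟩)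
      rw [sgen_of_mem hk.1 hk.2, sgen_of_mem hl.1 hl.2]
      simp only [_root_.map_mul, _root_.map_inv] at hrel
      exact mul_inv_eq_iff_eq_mul.1 (mul_inv_eq_one.1 hrel)
    · simp [sgen, dif_neg hl]
  · simp [sgen, dif_neg hk]

theorem sgen_braid {n k : ℕ} (h1 : 1 ≤ k) (hn : k + 1 ≤ n) :
    sgen n k * sgen n (k + 1) * sgen n k = sgen n (k + 1) * sgen n k * sgen n (k + 1) := by
  have hrel := PresentedGroup.one_of_mem
    (show _ ∈ braidRels n from Or.inr ⟨⟨k - 1, by omega⟩, ⟨k + 1 - 1, by omega⟩,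
      by simp only; omega, rfl⟩)
  rw [sgen_of_mem h1 (by omega), sgen_of_mem (by omega : 1 ≤ k + 1) hn]
  simp only [_root_.map_mul, _root_.map_inv] at hrel
  exact mul_inv_eq_iff_eq_mul.1 (mul_inv_eq_iff_eq_mul.1 (mul_inv_eq_one.1 hrel))

theorem dprod_succ (n : ℕ) {i j : ℕ} (h : i < j) :
    dprod n i (j + 1) = sgen n j * dprod n i j := by
  obtain ⟨m, rfl⟩ := Nat.exists_eq_add_of_lt h
  have h1 : i + m + 1 + 1 - 1 - i = m + 1 := by omega
  have h2 : i + m + 1 - 1 - i = m := by omega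
  rw [dprod, dprod, h1, h2, List.range_succ_eq_map, List.map_cons, List.prod_cons, List.map_map]
  congr 3
  funext t
  simp only [Function.comp_apply]
  congr 1
  omega

theorem commute_dprod {n i j : ℕ} {g : BraidGroup n}
    (h : ∀ k, i < k → k < j → Commute g (sgen n k)) : Commute g (dprod n i j) := by
  refine Commute.list_prod_right _ _ fun x hx => ?_
  obtain ⟨t, ht, rfl⟩ := List.mem_map.1 hx
  rw [List.mem_range] at ht
  exact h _ (by omega) (by omega)

theorem commute_agen {n i j : ℕ} (hij : i < j) {g : BraidGroup n}
    (h : ∀ k, i ≤ k → k < j → Commute g (sgen n k)) : Commute g (agen n i j) := by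
  have hd : Commute g (dprod n i j) := commute_dprod fun k hk hkj => h k hk.le hkj
  exact (hd.mul_right ((h i le_rfl hij).pow_right 2)).mul_right hd.inv_right

/-- Conjugation by the descending product lowers the index of an inner generator by one. -/
theorem dprod_semiconjBy {n r k s : ℕ} (hr : r < k) (hk : k + 1 < s) (hs : s ≤ n + 1) :
    SemiconjBy (dprod n r s) (sgen n (k + 1)) (sgen n k) := by
  induction s, hk using Nat.le_induction with
  | base =>
    rw [dprod_succ n (by omega : r < k + 1), dprod_succ n hr, ← mul_assoc]
    refine SemiconjBy.mul_left (y := sgen n (k + 1)) ?_ ?_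
    · rw [SemiconjBy, ← sgen_braid (by omega) (by omega), mul_assoc]
    · exact (commute_dprod fun l _ hl => (sgen_commute (by omega)).symm).symm
  | succ s hk ih =>
    rw [dprod_succ n (by omega : r < s)]
    exact SemiconjBy.mul_left (sgen_commute (by omega)).symm (ih (by omega))

theorem sgen_commute_agen {n r k s : ℕ} (hr : r < k) (hk : k + 1 < s) (hs : s ≤ n + 1) :
    Commute (sgen n k) (agen n r s) := by
  have hd := dprod_semiconjBy hr hk hs
  have hc : Commute (sgen n r ^ 2) (sgen n (k + 1)) := (sgen_commute (by omega)).pow_left 2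
  exact Commute.symm ((hd.mul_left hc).mul_left hd.inv_symm_left)

/-- Pure braid relation P1: `a_{ij}⁻¹ a_{rs} a_{ij} = a_{rs}` when `i<j<r<s` or `r<i<j<s`. -/
theorem statement1 (N : ℕ) (hN : 2 ≤ N) (i j r s : ℕ)
    (h : (1 ≤ i ∧ i < j ∧ j < r ∧ r < s ∧ s ≤ N) ∨
         (1 ≤ r ∧ r < i ∧ i < j ∧ j < s ∧ s ≤ N)) :
    (agen (N - 1) i j)⁻¹ * agen (N - 1) r s * agen (N - 1) i j = agen (N - 1) r s := by
  have hc : Commute (agen (N - 1) r s) (agen (N - 1) i j) := by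
    rcases h with ⟨_, hij, hjr, hrs, _⟩ | ⟨_, hri, hij, hjs, hsN⟩
    · exact commute_agen hij fun k _ hk =>
        (commute_agen hrs fun l hl _ => sgen_commute (by omega)).symm
    · exact commute_agen hij fun k hk hkj =>
        (sgen_commute_agen (by omega) (by omega) (by omega)).symm
  rw [mul_assoc, hc.eq, inv_mul_cancel_left]

end BraidPaper
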